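/- arXiv:0807.3522 — 5 statements merged into one kernel-verified Lean document; each statement's English description precedes it below -/
import Mathlib

section
/- Let g be an element of M^(2)(F), i.e. g ∈ GU(2,2;L) has rows (1,0,0,0), (0,α,0,β), (0,0,μ,0), (0,γ,0,δ) with α,β,γ,δ ∈ L and μ = ᾱδ − βγ̄ ∈ F^×. Then the quotient of any two entries of the 2×2 matrix B = [[α,β],[γ,δ]], whenever it is defined (the denominator entry is nonzero), lies in F. Consequently, if λ is any invertible (nonzero) entry of B, then λ^{-1}·B is a matrix with all entries in F and lies in GL₂(F). -/
open Matrix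

/-- In a quadratic extension, the elements fixed by a nontrivial automorphism come from the
base field. -/
theorem exists_algebraMap_eq_of_fixed_of_finrank_eq_two
    {F L : Type*} [Field F] [Field L] [Algebra F L]
    (hrank : Module.finrank F L = 2) (σ : L ≃ₐ[F] L) (hσ : σ ≠ AlgEquiv.refl)
    (x : L) (hx : σ x = x) : ∃ f : F, algebraMap F L f = x := by
  have := Subalgebra.isSimpleOrder_of_finrank hrank
  have hmem : x ∈ AlgHom.equalizer (σ : L →ₐ[F] L) (AlgHom.id F L) := hx
  rcases eq_bot_or_eq_top (AlgHom.equalizer (σ : L →ₐ[F] L) (AlgHom.id F L)) with h | h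
  · rw [h] at hmem
    exact Algebra.mem_bot.mp hmem
  · refine absurd (AlgEquiv.ext fun y => ?_) hσ
    have hy : y ∈ AlgHom.equalizer (σ : L →ₐ[F] L) (AlgHom.id F L) := h ▸ Algebra.mem_top
    exact hy

/-- **Entry ratios in the Klingen Levi factor `M⁽²⁾(F)` lie in `F`.**
Let `L/F` be a quadratic extension of fields of characteristic zero with nontrivial
`F`-automorphism `σ` ("conjugation"), and let `J = [[0,1₂],[-1₂,0]]`.
Suppose the matrix `g` with rows `(1,0,0,0), (0,α,0,β), (0,0,μ,0), (0,γ,0,δ)`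
(where `μ = σ(α)δ - βσ(γ)` is the image of a nonzero element `μ₀` of `F`)
lies in `GU(2,2;L)`, i.e. `ᵀ(σ g) * J * g = μ₀ • J` and `g` is invertible.
Then, writing `B = [[α,β],[γ,δ]]`:
(1) the quotient of any two entries of `B`, whenever defined, lies in `F`; and
(2) if `λ` is any nonzero entry of `B`, then `λ⁻¹ • B` comes from a matrix in
`GL₂(F)`. -/
theorem quotients_of_levi_entries_lie_in_base_field
    {F L : Type*} [Field F] [CharZero F] [Field L] [Algebra F L]
    (hrank : Module.finrank F L = 2) (σ : L ≃ₐ[F] L) (hσ : σ ≠ AlgEquiv.refl)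
    (α β γ δ : L) (μ₀ : F) (hμ₀ : μ₀ ≠ 0)
    (hμ : algebraMap F L μ₀ = σ α * δ - β * σ γ)
    (g : Matrix (Fin 4) (Fin 4) L)
    (hgdef : g = !![1, 0, 0, 0; 0, α, 0, β; 0, 0, algebraMap F L μ₀, 0; 0, γ, 0, δ])
    (hgunit : IsUnit g.det)
    (hgGU : (g.map σ)ᵀ * (!![0,0,1,0; 0,0,0,1; -1,0,0,0; 0,-1,0,0] : Matrix (Fin 4) (Fin 4) L) * g
      = algebraMap F L μ₀ • (!![0,0,1,0; 0,0,0,1; -1,0,0,0; 0,-1,0,0] : Matrix (Fin 4) (Fin 4) L)) :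
    (∀ i j k l : Fin 2, !![α, β; γ, δ] k l ≠ 0 →
        ∃ f : F, !![α, β; γ, δ] i j = algebraMap F L f * !![α, β; γ, δ] k l) ∧
    (∀ i j : Fin 2, !![α, β; γ, δ] i j ≠ 0 →
        ∃ B' : Matrix (Fin 2) (Fin 2) F, IsUnit B'.det ∧
          !![α, β; γ, δ] = !![α, β; γ, δ] i j • B'.map (algebraMap F L)) := by
  have h₁₁ := congrFun (congrFun hgGU 1) 1
  have h₃₃ := congrFun (congrFun hgGU 3) 3
  have h₃₁ := congrFun (congrFun hgGU 3) 1
  simp [hgdef, Matrix.mul_apply, Fin.sum_univ_four] at h₁₁ h₃₃ h₃₁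
  set m := algebraMap F L μ₀ with hm
  have hm0 : m ≠ 0 := by simpa [hm] using hμ₀
  set B : Matrix (Fin 2) (Fin 2) L := !![α, β; γ, δ] with hB
  have hconj : ∀ i j, σ (B i j) * B.det = m * B i j := by
    intro i j
    rw [Matrix.det_fin_two]
    fin_cases i <;> fin_cases j <;> simp [hB] <;> grind
  have hdet : B.det ≠ 0 := by
    intro h
    have hzero : ∀ i j, B i j = 0 := fun i j => by
      simpa [h, hm0] using hconj i j
    have hδ : δ = 0 := hzero 1 1
    have hβ : β = 0 := hzero 0 1
    exact hm0 (by rw [hμ, hδ, hβ]; ring)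
  have hratio : ∀ i j k l, B k l ≠ 0 → ∃ f : F, B i j = algebraMap F L f * B k l := by
    intro i j k l h
    obtain ⟨f, hf⟩ := exists_algebraMap_eq_of_fixed_of_finrank_eq_two hrank σ hσ
      (B i j / B k l) (by
        have hk : σ (B k l) ≠ 0 := by simpa using h
        rw [map_div₀, div_eq_div_iff hk h]
        apply mul_right_cancel₀ hdet
        linear_combination B k l * hconj i j - B i j * hconj k l)
    exact ⟨f, by rw [hf, div_mul_cancel₀ _ h]⟩
  refine ⟨hratio, fun i j h => ?_⟩
  choose f hf using fun k l => hratio k l i j h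
  have hBf : B = B i j • (Matrix.of f).map (algebraMap F L) := by
    ext k l
    rw [hf k l]
    simp [mul_comm]
  refine ⟨Matrix.of f, isUnit_iff_ne_zero.mpr fun h0 => hdet ?_, hBf⟩
  rw [hBf, Matrix.det_smul, ← RingHom.mapMatrix_apply, ← RingHom.map_det, h0, map_zero, mul_zero]
end

section
/- The map from L^× × GL₂(F) to M^(2)(F) sending (λ, [[α,β],[γ,δ]]) to the 4×4 matrix with rows (1,0,0,0), (0,λα,0,λβ), (0,0,N(λ)(αδ−βγ),0), (0,λγ,0,λδ), where N(λ) = λλ̄, is a surjective group homomorphism whose kernel is {(λ, λ^{-1}·I₂) : λ ∈ F^×}. -/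
open Matrix

theorem AlgEquiv.mem_range_algebraMap_of_finrank_eq_two {F L : Type*} [Field F] [Field L]
    [Algebra F L] (hrank : Module.finrank F L = 2) {σ : L ≃ₐ[F] L} (hσ : σ ≠ AlgEquiv.refl)
    {x : L} (hx : σ x = x) : ∃ a : F, algebraMap F L a = x := by
  have := IntermediateField.isSimpleOrder_of_finrank_prime F L (hrank ▸ Nat.prime_two)
  have hadjoin : x ∈ (⊥ : IntermediateField F L) := by
    rcases eq_bot_or_eq_top (IntermediateField.fixedField (Subgroup.zpowers σ)) with h | h
    · rw [← h, IntermediateField.mem_fixedField_iff]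
      intro f hf
      exact (MulAction.mem_stabilizer_iff (G := L ≃ₐ[F] L)).1
        (Subgroup.zpowers_le.2 (MulAction.mem_stabilizer_iff.2 hx) hf)
    · refine absurd (AlgEquiv.ext fun y => ?_) hσ
      have hy : y ∈ IntermediateField.fixedField (Subgroup.zpowers σ) := h ▸ trivial
      exact (IntermediateField.mem_fixedField_iff _ _).1 hy σ (Subgroup.mem_zpowers σ)
  exact IntermediateField.mem_bot.1 hadjoin

theorem AlgEquiv.apply_apply_of_finrank_eq_two {F L : Type*} [Field F] [Field L]
    [Algebra F L] (hrank : Module.finrank F L = 2) (σ : L ≃ₐ[F] L) (x : L) :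
    σ (σ x) = x := by
  have : FiniteDimensional F L := Module.finite_of_finrank_eq_succ hrank
  have hcard : Nat.card (L ≃ₐ[F] L) ≤ 2 := by
    rw [Nat.card_eq_fintype_card, ← hrank]
    exact AlgEquiv.card_le
  have hsq : σ ^ 2 = 1 := by
    have hdvd := orderOf_dvd_natCard σ
    have hpos : 0 < Nat.card (L ≃ₐ[F] L) := Nat.card_pos
    interval_cases h : Nat.card (L ≃ₐ[F] L)
    · exact orderOf_dvd_iff_pow_eq_one.1 (hdvd.trans (one_dvd 2))
    · exact orderOf_dvd_iff_pow_eq_one.1 hdvd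
  simpa [pow_two] using congrArg (fun τ : L ≃ₐ[F] L => τ x) hsq

/-- If `σ l * x` is fixed by `σ`, then `x` is a multiple of `l` by an element of the base field. -/
theorem exists_eq_mul_algebraMap_of_map_mul {F L : Type*} [Field F] [Field L]
    [Algebra F L] (hrank : Module.finrank F L = 2) {σ : L ≃ₐ[F] L} (hσ : σ ≠ AlgEquiv.refl)
    {l x : L} (hl : l ≠ 0) (h : σ l * x = σ x * l) : ∃ a : F, x = l * algebraMap F L a := by
  have hl' : σ l ≠ 0 := by simpa using hl
  obtain ⟨a, ha⟩ := AlgEquiv.mem_range_algebraMap_of_finrank_eq_two hrank hσ (x := x / l) (by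
    rw [map_div₀, div_eq_div_iff hl' hl, ← h, mul_comm])
  exact ⟨a, by rw [ha, mul_div_cancel₀ _ hl]⟩

/-- A unitary similitude of the skew form in two variables is a scalar multiple of a matrix
over the base field. -/
theorem exists_scalar_mul_of_unitary_similitude {F L : Type*} [Field F] [Field L]
    [Algebra F L] (hrank : Module.finrank F L = 2) {σ : L ≃ₐ[F] L} (hσ : σ ≠ AlgEquiv.refl)
    {α β γ δ : L} {μ : F} (hμ : μ ≠ 0) (h₁ : σ α * γ = σ γ * α) (h₂ : σ β * δ = σ δ * β)
    (h₃ : σ α * δ - σ γ * β = algebraMap F L μ) :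
    ∃ l : L, l ≠ 0 ∧ ∃ a b c d : F, α = l * algebraMap F L a ∧ β = l * algebraMap F L b ∧
      γ = l * algebraMap F L c ∧ δ = l * algebraMap F L d := by
  have hinv := AlgEquiv.apply_apply_of_finrank_eq_two hrank σ
  have h₄ : α * σ δ - γ * σ β = algebraMap F L μ := by
    simpa [hinv] using congrArg σ h₃
  have hμ' : algebraMap F L μ ≠ 0 := by simpa using hμ
  by_cases hα : α = 0
  · subst hα
    simp only [map_zero, zero_mul, zero_sub] at h₃ h₄
    have hγ : γ ≠ 0 := by rintro rfl; simp at h₃; exact hμ' h₃.symm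
    have hβ : β ≠ 0 := by rintro rfl; simp at h₃; exact hμ' h₃.symm
    obtain ⟨b, hb⟩ := exists_eq_mul_algebraMap_of_map_mul hrank hσ hγ (x := β) (by
      linear_combination h₄ - h₃)
    obtain ⟨d, hd⟩ := exists_eq_mul_algebraMap_of_map_mul hrank hσ hβ h₂
    exact ⟨γ, hγ, 0, b, 1, b * d, by simp, hb, by simp, by rw [hd, hb, map_mul, mul_assoc]⟩
  · obtain ⟨c, rfl⟩ := exists_eq_mul_algebraMap_of_map_mul hrank hσ hα h₁
    simp only [map_mul, AlgEquiv.commutes] at h₃ h₄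
    have hs : δ - algebraMap F L c * β ≠ 0 := by
      intro h
      apply hμ'
      linear_combination -h₃ + σ α * h
    obtain ⟨e, he⟩ := exists_eq_mul_algebraMap_of_map_mul hrank hσ hα
      (x := δ - algebraMap F L c * β) (by
        simp only [map_sub, map_mul, AlgEquiv.commutes]
        linear_combination h₃ - h₄)
    obtain ⟨b, hb⟩ := exists_eq_mul_algebraMap_of_map_mul hrank hσ hs (x := β) (by
      simp only [map_sub, map_mul, AlgEquiv.commutes]
      linear_combination -h₂)
    have hb' : β = α * algebraMap F L (e * b) := by rw [hb, he, map_mul, mul_assoc]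
    refine ⟨α, hα, 1, e * b, c, e + c * (e * b), by simp, hb', rfl, ?_⟩
    rw [map_add, map_mul _ c]
    linear_combination he + algebraMap F L c * hb'

theorem leviMatrix_unitary_iff {F L : Type*} [Field F] [Field L] [Algebra F L]
    (σ : L ≃ₐ[F] L) (α β γ δ m : L) (μ : F) :
    ((!![1,0,0,0; 0,α,0,β; 0,0,m,0; 0,γ,0,δ] : Matrix (Fin 4) (Fin 4) L).map σ)ᵀ *
        !![0,0,1,0; 0,0,0,1; -1,0,0,0; 0,-1,0,0] * !![1,0,0,0; 0,α,0,β; 0,0,m,0; 0,γ,0,δ] =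
        algebraMap F L μ • (!![0,0,1,0; 0,0,0,1; -1,0,0,0; 0,-1,0,0] : Matrix (Fin 4) (Fin 4) L) ↔
      m = algebraMap F L μ ∧ σ m = algebraMap F L μ ∧ σ α * γ = σ γ * α ∧
        σ β * δ = σ δ * β ∧ σ α * δ - σ γ * β = algebraMap F L μ ∧
        σ δ * α - σ β * γ = algebraMap F L μ := by
  rw [← Matrix.ext_iff]
  simp [Fin.forall_fin_succ, Matrix.mul_apply, Fin.sum_univ_four]
  grind

theorem det_leviMatrix {R : Type*} [CommRing R] (α β γ δ m : R) :
    (!![1,0,0,0; 0,α,0,β; 0,0,m,0; 0,γ,0,δ] : Matrix (Fin 4) (Fin 4) R).det =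
      m * (α * δ - β * γ) := by
  simp [Matrix.det_succ_row_zero, Fin.sum_univ_succ, Fin.succAbove]
  ring

/-- **The structure map `L^× × GL₂(F) → M⁽²⁾(F)`.**
Let `L/F` be a quadratic extension of fields of characteristic zero with nontrivial
conjugation `σ`, `N(λ) = λ·σλ`, and `J = [[0,1₂],[-1₂,0]]`.  The map `Φ` sending
`(λ, [[a,b],[c,d]])` to the matrix with rows
`(1,0,0,0), (0,λa,0,λb), (0,0,N(λ)(ad-bc),0), (0,λc,0,λd)` is a surjective group
homomorphism onto `M⁽²⁾(F)` (the subgroup of `GU(2,2;L)` of matrices of that shape),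
with kernel `{(λ, λ⁻¹·1₂) : λ ∈ F^×}`. -/
theorem structure_map_onto_levi_M2_surjective_with_kernel
    {F L : Type*} [Field F] [CharZero F] [Field L] [Algebra F L]
    (hrank : Module.finrank F L = 2) (σ : L ≃ₐ[F] L) (hσ : σ ≠ AlgEquiv.refl)
    (J : Matrix (Fin 4) (Fin 4) L)
    (hJ : J = !![0,0,1,0; 0,0,0,1; -1,0,0,0; 0,-1,0,0])
    (M2 : Set (Matrix (Fin 4) (Fin 4) L))
    (hM2 : M2 = {g | (∃ α β γ δ μL : L, g = !![1,0,0,0; 0,α,0,β; 0,0,μL,0; 0,γ,0,δ]) ∧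
      IsUnit g.det ∧ ∃ μ : F, μ ≠ 0 ∧ (g.map σ)ᵀ * J * g = algebraMap F L μ • J})
    (Φ : Lˣ × GL (Fin 2) F → Matrix (Fin 4) (Fin 4) L)
    (hΦ : ∀ p : Lˣ × GL (Fin 2) F, Φ p =
      !![1, 0, 0, 0;
         0, (p.1 : L) * algebraMap F L ((p.2 : Matrix (Fin 2) (Fin 2) F) 0 0), 0,
            (p.1 : L) * algebraMap F L ((p.2 : Matrix (Fin 2) (Fin 2) F) 0 1);
         0, 0, ((p.1 : L) * σ (p.1 : L)) *
            algebraMap F L (p.2 : Matrix (Fin 2) (Fin 2) F).det, 0;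
         0, (p.1 : L) * algebraMap F L ((p.2 : Matrix (Fin 2) (Fin 2) F) 1 0), 0,
            (p.1 : L) * algebraMap F L ((p.2 : Matrix (Fin 2) (Fin 2) F) 1 1)]) :
    (∀ p q : Lˣ × GL (Fin 2) F, Φ (p * q) = Φ p * Φ q) ∧
    (∀ p : Lˣ × GL (Fin 2) F, Φ p ∈ M2) ∧
    (∀ g ∈ M2, ∃ p : Lˣ × GL (Fin 2) F, Φ p = g) ∧
    (∀ p : Lˣ × GL (Fin 2) F, Φ p = 1 ↔ ∃ t : Fˣ,
      (p.1 : L) = algebraMap F L (t : F) ∧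
      (p.2 : Matrix (Fin 2) (Fin 2) F) = ((t⁻¹ : Fˣ) : F) • (1 : Matrix (Fin 2) (Fin 2) F)) := by
  subst hJ hM2
  have hdet (p : Lˣ × GL (Fin 2) F) : (p.2 : Matrix (Fin 2) (Fin 2) F).det ≠ 0 :=
    p.2.det_ne_zero
  have hinv := AlgEquiv.apply_apply_of_finrank_eq_two hrank σ
  refine ⟨fun p q => ?_, fun p => ?_, ?_, fun p => ?_⟩
  · rw [hΦ, hΦ, hΦ, ← Matrix.ext_iff]
    simp [Fin.forall_fin_succ, Matrix.mul_apply, Fin.sum_univ_succ]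
    refine ⟨⟨?_, ?_⟩, ?_, ?_, ?_⟩ <;> ring
  · have hl := p.1.ne_zero
    have hσl : σ (p.1 : L) ≠ 0 := by simp
    obtain ⟨n, hn⟩ := AlgEquiv.mem_range_algebraMap_of_finrank_eq_two hrank hσ
      (x := (p.1 : L) * σ p.1) (by rw [map_mul, hinv, mul_comm])
    have hd : algebraMap F L (p.2 : Matrix (Fin 2) (Fin 2) F).det ≠ 0 := by
      simpa using hdet p
    have hn0 : n ≠ 0 := by
      rintro rfl
      exact mul_ne_zero hl hσl (by simpa using hn.symm)
    refine ⟨⟨_, _, _, _, _, hΦ p⟩, ?_, n * (p.2 : Matrix (Fin 2) (Fin 2) F).det,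
      mul_ne_zero hn0 (hdet p), ?_⟩
    · rw [hΦ, det_leviMatrix, isUnit_iff_ne_zero]
      refine mul_ne_zero (mul_ne_zero (mul_ne_zero hl hσl) hd) ?_
      convert mul_ne_zero (mul_ne_zero hl hl) hd using 1
      rw [Matrix.det_fin_two, map_sub, map_mul, map_mul]
      ring
    · rw [hΦ, leviMatrix_unitary_iff]
      simp only [map_mul, AlgEquiv.commutes, hinv, hn, Matrix.det_fin_two, map_sub]
      refine ⟨trivial, ?_, ?_, ?_, ?_, ?_⟩ <;> ring
  · rintro _ ⟨⟨α, β, γ, δ, m, rfl⟩, -, μ, hμ, h⟩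
    obtain ⟨hm, -, h₁, h₂, h₃, -⟩ := (leviMatrix_unitary_iff σ α β γ δ m μ).1 h
    obtain ⟨l, hl, a, b, c, d, rfl, rfl, rfl, rfl⟩ :=
      exists_scalar_mul_of_unitary_similitude hrank hσ hμ h₁ h₂ h₃
    simp only [map_mul, AlgEquiv.commutes] at h₃
    have hμeq : (l * σ l) * algebraMap F L (a * d - b * c) = algebraMap F L μ := by
      rw [← h₃, map_sub, map_mul, map_mul]
      ring
    have had : (!![a, b; c, d] : Matrix (Fin 2) (Fin 2) F).det ≠ 0 := by
      rw [Matrix.det_fin_two_of]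
      intro h0
      rw [h0, map_zero, mul_zero] at hμeq
      exact hμ (by simpa using hμeq.symm)
    refine ⟨(Units.mk0 l hl, Matrix.GeneralLinearGroup.mkOfDetNeZero !![a, b; c, d] had), ?_⟩
    rw [hΦ, hm, ← hμeq]
    simp [Matrix.GeneralLinearGroup.mkOfDetNeZero, Matrix.det_fin_two_of]
  · have hl := p.1.ne_zero
    rw [hΦ]
    constructor
    · intro h
      have h11 := congrFun₂ h 1 1
      have h13 := congrFun₂ h 1 3
      have h31 := congrFun₂ h 3 1
      have h33 := congrFun₂ h 3 3
      simp [hl] at h11 h13 h31 h33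
      have ha : (p.2 : Matrix (Fin 2) (Fin 2) F) 0 0 ≠ 0 := by
        intro h0
        simp [h0] at h11
      have hda : (p.2 : Matrix (Fin 2) (Fin 2) F) 1 1 = (p.2 : Matrix (Fin 2) (Fin 2) F) 0 0 :=
        (algebraMap F L).injective (mul_left_cancel₀ hl (h33.trans h11.symm))
      refine ⟨(Units.mk0 _ ha)⁻¹, ?_, ?_⟩
      · simpa using eq_inv_of_mul_eq_one_left h11
      · ext i j
        fin_cases i <;> fin_cases j <;> simp [h13, h31, hda]
    · rintro ⟨t, h₁, h₂⟩
      have ht : algebraMap F L (t : F) ≠ 0 := by simp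
      rw [h₁, h₂, ← Matrix.ext_iff]
      simp [Fin.forall_fin_succ, ht]
      field_simp
end

section
/- A matrix g ∈ GL₂(F) satisfies ᵀg S g = det(g)·S if and only if g = x·I₂ + y·ξ for some x, y ∈ F, where ξ = [[b/2, c],[−a, −b/2]]. In other words, the group T(F) := {g ∈ GL₂(F) : ᵀg S g = det(g)·S} equals the group of invertible elements of the two-dimensional commutative F-subalgebra F(ξ) = F·I₂ + F·ξ of M₂(F). -/
open Matrix

/-- For `g` with unit determinant, being a similitude of the bilinear form `S` with factor `det g`
is a linear condition on the entries of `g`. -/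
theorem Matrix.transpose_mul_mul_eq_det_smul_iff {n R : Type*} [Fintype n] [DecidableEq n]
    [CommRing R] (S g : Matrix n n R) (hg : IsUnit g.det) :
    gᵀ * S * g = g.det • S ↔ gᵀ * S = S * g.adjugate := by
  constructor
  · intro h
    have h' := congrArg (· * g.adjugate) h
    simp only [Matrix.mul_assoc, mul_adjugate, Matrix.smul_mul, Matrix.mul_smul,
      Matrix.mul_one] at h'
    exact hg.smul_left_cancel.mp h'
  · intro h
    rw [h, Matrix.mul_assoc, adjugate_mul, Matrix.mul_smul, Matrix.mul_one]

/-- A vector `(t, q, r)` whose cross product with `(b, c, -a) ≠ 0` vanishes is a multiple of it. -/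
theorem exists_eq_mul_of_cross_eq_zero {F : Type*} [Field F] {a b c t q r : F}
    (hd : b ^ 2 - 4 * a * c ≠ 0) (h₁ : a * t + b * r = 0) (h₂ : c * r + a * q = 0)
    (h₃ : b * q = c * t) : ∃ y, t = y * b ∧ q = y * c ∧ r = -(y * a) := by
  by_cases hb : b = 0
  · have ha : a ≠ 0 := by
      rintro rfl
      simp [hb] at hd
    subst hb
    have ht : t = 0 := by simpa [ha] using h₁
    refine ⟨-r / a, by simp [ht], ?_, ?_⟩
    · field_simp
      linear_combination h₂
    · field_simp
  · refine ⟨t / b, ?_, ?_, ?_⟩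
    · field_simp
    · field_simp
      linear_combination h₃
    · field_simp
      linear_combination h₁

/-- **The Bessel torus as the unit group of `F(ξ)`.**
Let `F` be a field of characteristic zero, `a b c ∈ F` with `d = b² - 4ac ≠ 0`,
`S = [[a, b/2],[b/2, c]]` and `ξ = [[b/2, c],[-a, -b/2]]`.  A matrix
`g ∈ GL₂(F)` satisfies `ᵀg S g = det g • S` if and only if `g = x•1 + y•ξ`
for some `x, y ∈ F`; that is, `T(F)` equals the group of invertible elements of the
two-dimensional commutative `F`-algebra `F(ξ) = F·1 + F·ξ`. -/
theorem mem_besselTorus_iff_mem_quadratic_algebra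
    {F : Type*} [Field F] [CharZero F] (a b c : F) (hd : b ^ 2 - 4 * a * c ≠ 0)
    (g : Matrix (Fin 2) (Fin 2) F) (hg : IsUnit g.det) :
    gᵀ * !![a, b / 2; b / 2, c] * g = g.det • !![a, b / 2; b / 2, c] ↔
      ∃ x y : F, g = x • (1 : Matrix (Fin 2) (Fin 2) F) + y • !![b / 2, c; -a, -b / 2] := by
  rw [Matrix.transpose_mul_mul_eq_det_smul_iff _ g hg]
  constructor
  · intro h
    have h₁ := congrFun (congrFun h 0) 0
    have h₂ := congrFun (congrFun h 0) 1
    have h₃ := congrFun (congrFun h 1) 1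
    simp only [adjugate_fin_two, mul_apply, Fin.sum_univ_two, transpose_apply, of_apply,
      cons_val', cons_val_zero, cons_val_one, cons_val_fin_one] at h₁ h₂ h₃
    obtain ⟨y, ht, hq, hr⟩ := exists_eq_mul_of_cross_eq_zero (t := g 0 0 - g 1 1) (q := g 0 1)
      (r := g 1 0) hd (by linear_combination h₁) (by linear_combination h₂)
      (by linear_combination h₃)
    refine ⟨(g 0 0 + g 1 1) / 2, y, ?_⟩
    ext i j
    fin_cases i <;> fin_cases j <;> simp
    · linear_combination ht / 2
    · exact hq
    · exact hr
    · linear_combination -ht / 2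
  · rintro ⟨x, y, rfl⟩
    ext i j
    fin_cases i <;> fin_cases j <;>
      simp [adjugate_fin_two, mul_apply, Fin.sum_univ_two] <;> ring
end

section
/- There exists t₀ ∈ GL₂(ℝ) with det t₀ > 0 such that T¹ = t₀·SO(2)·t₀^{-1}; and for any such t₀, one has the decomposition GL₂⁺(ℝ) = T(ℝ)·t₀·{diag(ζ, ζ^{-1}) : ζ ≥ 1}·SO(2), i.e., every g ∈ GL₂(ℝ) with det g > 0 can be written as g = t·t₀·diag(ζ, ζ^{-1})·k with t ∈ T(ℝ), ζ ∈ [1,∞), and k ∈ SO(2). -/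
open Matrix Real

/-- The rotation matrix of angle `θ`. -/
noncomputable def planeRotation (θ : ℝ) : Matrix (Fin 2) (Fin 2) ℝ :=
  !![Real.cos θ, Real.sin θ; -Real.sin θ, Real.cos θ]

lemma planeRotation_transpose_mul_self (θ : ℝ) :
    (planeRotation θ)ᵀ * planeRotation θ = 1 := by
  have h := Real.sin_sq_add_cos_sq θ
  ext i j
  fin_cases i <;> fin_cases j <;> simp [planeRotation, Matrix.mul_apply, Fin.sum_univ_two] <;>
    linarith

lemma det_planeRotation (θ : ℝ) : (planeRotation θ).det = 1 := by
  have h := Real.sin_sq_add_cos_sq θ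
  simp only [planeRotation, det_fin_two_of]
  linarith

lemma exists_polar_coordinates (x y : ℝ) :
    ∃ r θ : ℝ, 0 ≤ r ∧ x = r * Real.cos θ ∧ y = r * Real.sin θ :=
  ⟨‖(⟨x, y⟩ : ℂ)‖, Complex.arg ⟨x, y⟩, norm_nonneg _,
    (Complex.norm_mul_cos_arg ⟨x, y⟩).symm, (Complex.norm_mul_sin_arg ⟨x, y⟩).symm⟩

lemma exists_eq_planeRotation {k : Matrix (Fin 2) (Fin 2) ℝ} (hk : kᵀ * k = 1)
    (hdet : k.det = 1) : ∃ θ, k = planeRotation θ := by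
  have h00 := congrFun (congrFun hk 0) 0
  have h11 := congrFun (congrFun hk 1) 1
  simp only [Matrix.mul_apply, Fin.sum_univ_two, transpose_apply, one_apply_eq] at h00 h11
  rw [det_fin_two] at hdet
  have hd : k 1 1 = k 0 0 := by nlinarith [sq_nonneg (k 0 0 - k 1 1), sq_nonneg (k 0 1 + k 1 0)]
  have ho : k 1 0 = -k 0 1 := by nlinarith [sq_nonneg (k 0 0 - k 1 1), sq_nonneg (k 0 1 + k 1 0)]
  obtain ⟨r, θ, hr, hx, hy⟩ := exists_polar_coordinates (k 0 0) (k 0 1)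
  have hr1 : r = 1 := by
    have h := Real.sin_sq_add_cos_sq θ
    rw [hd, ho, hx, hy] at hdet
    have : r ^ 2 = 1 := by linear_combination hdet - r ^ 2 * h
    nlinarith
  subst hr1
  refine ⟨θ, ?_⟩
  ext i j
  fin_cases i <;> fin_cases j <;> simp [planeRotation, hd, ho, hx, hy]

/-- The Cartan decomposition of `GL₂⁺(ℝ)` with respect to `SO(2)`. -/
lemma exists_smul_planeRotation_mul_diag_mul_planeRotation {h : Matrix (Fin 2) (Fin 2) ℝ}
    (hh : 0 < h.det) :
    ∃ r φ ζ θ : ℝ, 0 < r ∧ 1 ≤ ζ ∧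
      h = r • planeRotation φ * !![ζ, 0; 0, ζ⁻¹] * planeRotation θ := by
  obtain ⟨α, u, hα, h1, h2⟩ :=
    exists_polar_coordinates ((h 0 0 + h 1 1) / 2) ((h 0 1 - h 1 0) / 2)
  obtain ⟨β, v, hβ, h3, h4⟩ :=
    exists_polar_coordinates ((h 0 0 - h 1 1) / 2) (-(h 0 1 + h 1 0) / 2)
  obtain ⟨φ, θ, rfl, rfl⟩ : ∃ φ θ : ℝ, u = φ + θ ∧ v = φ - θ :=
    ⟨(u + v) / 2, (u - v) / 2, by ring, by ring⟩
  have hαβ : β < α := by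
    have hu := Real.sin_sq_add_cos_sq (φ + θ)
    have hv := Real.sin_sq_add_cos_sq (φ - θ)
    rw [det_fin_two] at hh
    have : h 0 0 * h 1 1 - h 0 1 * h 1 0 = α ^ 2 - β ^ 2 := by
      calc _ = ((h 0 0 + h 1 1) / 2) ^ 2 + ((h 0 1 - h 1 0) / 2) ^ 2
            - (((h 0 0 - h 1 1) / 2) ^ 2 + (-(h 0 1 + h 1 0) / 2) ^ 2) := by ring
        _ = _ := by
          rw [h1, h2, h3, h4]
          linear_combination α ^ 2 * hu - β ^ 2 * hv
    nlinarith
  have hy : 0 < α - β := by linarith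
  have hx : 0 < α + β := by linarith
  have hsx := Real.sqrt_pos.2 hx
  have hsy := Real.sqrt_pos.2 hy
  have hx2 := Real.mul_self_sqrt hx.le
  have hy2 := Real.mul_self_sqrt hy.le
  refine ⟨√(α + β) * √(α - β), φ, √(α + β) / √(α - β), θ, by positivity, ?_, ?_⟩
  · rw [one_le_div hsy]
    exact Real.sqrt_le_sqrt (by linarith)
  have hrζ : √(α + β) * √(α - β) * (√(α + β) / √(α - β)) = α + β := by
    field_simp
    linarith
  have hrζ' : √(α + β) * √(α - β) * (√(α + β) / √(α - β))⁻¹ = α - β := by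
    field_simp
    linarith
  have key : (√(α + β) * √(α - β)) • planeRotation φ *
      !![√(α + β) / √(α - β), 0; 0, (√(α + β) / √(α - β))⁻¹] =
      planeRotation φ * !![α + β, 0; 0, α - β] := by
    rw [smul_mul_assoc, ← mul_smul_comm]
    simp only [smul_of, smul_cons, smul_empty, smul_eq_mul, mul_zero, hrζ, hrζ']
  rw [key]
  rw [Real.cos_add] at h1
  rw [Real.sin_add] at h2
  rw [Real.cos_sub] at h3
  rw [Real.sin_sub] at h4
  ext i j
  fin_cases i <;> fin_cases j <;>
    simp [planeRotation, Matrix.mul_apply, Fin.sum_univ_two]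
  · linear_combination h1 + h3
  · linear_combination h2 - h4
  · linear_combination -h2 - h4
  · linear_combination h1 - h3

section Conjugation

variable {S t₀ : Matrix (Fin 2) (Fin 2) ℝ} {l : ℝ}

/-- Conjugating a similitude of the standard form gives a similitude of `S`. -/
lemma transpose_mul_mul_conj (ht : IsUnit t₀.det) (hS : t₀ᵀ * S * t₀ = l • 1)
    {k : Matrix (Fin 2) (Fin 2) ℝ} {m : ℝ} (hk : kᵀ * k = m • 1) :
    (t₀ * k * t₀⁻¹)ᵀ * S * (t₀ * k * t₀⁻¹) = m • S := by
  have hS' : S = t₀⁻¹ᵀ * (l • 1) * t₀⁻¹ := by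
    rw [← hS, transpose_nonsing_inv]
    have ht' : IsUnit t₀ᵀ.det := by rwa [det_transpose]
    simp only [Matrix.mul_assoc, Matrix.mul_nonsing_inv _ ht, Matrix.mul_one]
    rw [← Matrix.mul_assoc, Matrix.nonsing_inv_mul _ ht', Matrix.one_mul]
  calc (t₀ * k * t₀⁻¹)ᵀ * S * (t₀ * k * t₀⁻¹)
      = t₀⁻¹ᵀ * (kᵀ * (t₀ᵀ * S * t₀) * k) * t₀⁻¹ := by
        simp only [transpose_mul, Matrix.mul_assoc]
    _ = m • (t₀⁻¹ᵀ * (l • 1) * t₀⁻¹) := by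
        rw [hS]
        simp [hk, smul_comm m l]
    _ = m • S := by rw [← hS']

lemma setOf_isometry_eq_conj_planeRotation (ht : IsUnit t₀.det) (hl : l ≠ 0)
    (hS : t₀ᵀ * S * t₀ = l • 1) :
    {g : Matrix (Fin 2) (Fin 2) ℝ | IsUnit g.det ∧ gᵀ * S * g = g.det • S ∧ g.det = 1}
      = (fun k => t₀ * k * t₀⁻¹) '' {k | ∃ θ : ℝ, k = planeRotation θ} := by
  ext g
  constructor
  · rintro ⟨-, hg, hdet⟩
    rw [hdet, one_smul] at hg
    have hconj : t₀ * (t₀⁻¹ * g * t₀) * t₀⁻¹ = g := by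
      simp only [Matrix.mul_assoc, Matrix.mul_nonsing_inv _ ht, Matrix.mul_one]
      rw [← Matrix.mul_assoc, Matrix.mul_nonsing_inv _ ht, Matrix.one_mul]
    refine ⟨t₀⁻¹ * g * t₀, exists_eq_planeRotation ?_ ?_, hconj⟩
    · have hk : t₀ * (t₀⁻¹ * g * t₀) = g * t₀ := by
        rw [Matrix.mul_assoc, Matrix.mul_nonsing_inv_cancel_left _ _ ht]
      refine smul_right_injective _ hl ?_
      calc l • ((t₀⁻¹ * g * t₀)ᵀ * (t₀⁻¹ * g * t₀))
          = (t₀⁻¹ * g * t₀)ᵀ * (l • 1) * (t₀⁻¹ * g * t₀) := by simp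
        _ = (t₀ * (t₀⁻¹ * g * t₀))ᵀ * S * (t₀ * (t₀⁻¹ * g * t₀)) := by
            rw [← hS, transpose_mul t₀]
            simp only [Matrix.mul_assoc]
        _ = t₀ᵀ * (gᵀ * S * g) * t₀ := by
            rw [hk, transpose_mul]
            simp only [Matrix.mul_assoc]
        _ = l • 1 := by rw [hg, hS]
    · rw [← hdet, ← det_conj' ((Matrix.isUnit_iff_isUnit_det _).2 ht) g]
  · rintro ⟨_, ⟨θ, rfl⟩, rfl⟩
    have hdet : (t₀ * planeRotation θ * t₀⁻¹).det = 1 := by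
      rw [det_conj ((Matrix.isUnit_iff_isUnit_det _).2 ht), det_planeRotation]
    refine ⟨by simp [hdet], ?_, hdet⟩
    rw [hdet]
    exact transpose_mul_mul_conj ht hS (by rw [planeRotation_transpose_mul_self, one_smul])

/-- A symmetric form which is preserved by the quarter turn is scalar. -/
lemma exists_transpose_mul_mul_eq_smul_one (ht : IsUnit t₀.det) (hsymm : S.IsSymm)
    (hJ : (t₀ * planeRotation (π / 2) * t₀⁻¹)ᵀ * S * (t₀ * planeRotation (π / 2) * t₀⁻¹) = S) :
    ∃ l : ℝ, t₀ᵀ * S * t₀ = l • 1 := by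
  have hM : (planeRotation (π / 2))ᵀ * (t₀ᵀ * S * t₀) * planeRotation (π / 2)
      = t₀ᵀ * S * t₀ := by
    have hc : t₀ * planeRotation (π / 2) * t₀⁻¹ * t₀ = t₀ * planeRotation (π / 2) := by
      rw [Matrix.mul_assoc, Matrix.nonsing_inv_mul _ ht, Matrix.mul_one]
    calc _ = (t₀ * planeRotation (π / 2))ᵀ * S * (t₀ * planeRotation (π / 2)) := by
          simp only [transpose_mul, Matrix.mul_assoc]
      _ = (t₀ * planeRotation (π / 2) * t₀⁻¹ * t₀)ᵀ * S *
            (t₀ * planeRotation (π / 2) * t₀⁻¹ * t₀) := by rw [hc]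
      _ = t₀ᵀ * ((t₀ * planeRotation (π / 2) * t₀⁻¹)ᵀ * S *
            (t₀ * planeRotation (π / 2) * t₀⁻¹)) * t₀ := by
          rw [transpose_mul _ t₀]
          simp only [Matrix.mul_assoc]
      _ = _ := by rw [hJ]
  have hMs : (t₀ᵀ * S * t₀)ᵀ = t₀ᵀ * S * t₀ := by
    rw [transpose_mul, transpose_mul, transpose_transpose, hsymm.eq, Matrix.mul_assoc]
  generalize t₀ᵀ * S * t₀ = M at hM hMs
  have e0 := congrFun (congrFun hM 0) 0
  have e1 := congrFun (congrFun hM 0) 1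
  have e2 := congrFun (congrFun hMs 0) 1
  simp [planeRotation, Matrix.mul_apply, Fin.sum_univ_two] at e0 e1 e2
  refine ⟨M 0 0, ?_⟩
  ext i j
  fin_cases i <;> fin_cases j <;> simp <;> linarith

end Conjugation

/-- **Cartan-type decomposition of `GL₂⁺(ℝ)` along the compact torus `T¹`.**
Let `a, b, c ∈ ℝ` with `S = [[a,b/2],[b/2,c]]` positive definite, and
`T(ℝ) = {g ∈ GL₂(ℝ) : ᵀg S g = det g • S}`, `T¹ = T(ℝ) ∩ SL₂(ℝ)`.  Then there is
`t₀ ∈ GL₂⁺(ℝ)` with `T¹ = t₀·SO(2)·t₀⁻¹`; and for any such `t₀`, every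
`g ∈ GL₂⁺(ℝ)` can be written `g = t·t₀·diag(ζ,ζ⁻¹)·k` with `t ∈ T(ℝ)`, `ζ ≥ 1`
and `k ∈ SO(2)`. -/
theorem cartan_decomposition_along_bessel_torus
    (a b c : ℝ) (hS : (!![a, b / 2; b / 2, c] : Matrix (Fin 2) (Fin 2) ℝ).PosDef) :
    (∃ t₀ : Matrix (Fin 2) (Fin 2) ℝ, 0 < t₀.det ∧
      {g : Matrix (Fin 2) (Fin 2) ℝ | IsUnit g.det ∧
          gᵀ * !![a, b / 2; b / 2, c] * g = g.det • !![a, b / 2; b / 2, c] ∧ g.det = 1}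
        = (fun k => t₀ * k * t₀⁻¹) ''
            {k | ∃ θ : ℝ, k = !![Real.cos θ, Real.sin θ; -Real.sin θ, Real.cos θ]}) ∧
    (∀ t₀ : Matrix (Fin 2) (Fin 2) ℝ, 0 < t₀.det →
      {g : Matrix (Fin 2) (Fin 2) ℝ | IsUnit g.det ∧
          gᵀ * !![a, b / 2; b / 2, c] * g = g.det • !![a, b / 2; b / 2, c] ∧ g.det = 1}
        = (fun k => t₀ * k * t₀⁻¹) ''
            {k | ∃ θ : ℝ, k = !![Real.cos θ, Real.sin θ; -Real.sin θ, Real.cos θ]} →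
      ∀ g : Matrix (Fin 2) (Fin 2) ℝ, 0 < g.det →
        ∃ (t : Matrix (Fin 2) (Fin 2) ℝ) (ζ : ℝ) (θ : ℝ),
          (IsUnit t.det ∧ tᵀ * !![a, b / 2; b / 2, c] * t = t.det • !![a, b / 2; b / 2, c]) ∧
          1 ≤ ζ ∧
          g = t * t₀ * !![ζ, 0; 0, ζ⁻¹] *
                !![Real.cos θ, Real.sin θ; -Real.sin θ, Real.cos θ]) := by
  have hsymm : (!![a, b / 2; b / 2, c] : Matrix (Fin 2) (Fin 2) ℝ).IsSymm := by
    ext i j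
    fin_cases i <;> fin_cases j <;> rfl
  have ha : 0 < a := by simpa using hS.diag_pos (i := 0)
  have hD : 0 < a * c - b / 2 * (b / 2) := by simpa [det_fin_two_of] using hS.det_pos
  constructor
  · have hs := Real.sqrt_pos.2 hD
    have hs2 := Real.mul_self_sqrt hD.le
    have hdet : 0 < (!![√(a * c - b / 2 * (b / 2)), -(b / 2); 0, a]).det := by
      rw [det_fin_two_of]
      linarith [mul_pos hs ha]
    refine ⟨_, hdet, setOf_isometry_eq_conj_planeRotation hdet.ne'.isUnit
      (l := a * (a * c - b / 2 * (b / 2))) (by positivity) ?_⟩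
    generalize √(a * c - b / 2 * (b / 2)) = s at hs2
    ext i j
    fin_cases i <;> fin_cases j <;> simp [Matrix.mul_apply, Fin.sum_univ_two]
    · linear_combination a * hs2
    · ring
    · exact Or.inl (by ring)
    · ring
  · intro t₀ ht₀ hT g hg
    have ht : IsUnit t₀.det := ht₀.ne'.isUnit
    obtain ⟨l, hl⟩ : ∃ l : ℝ, t₀ᵀ * !![a, b / 2; b / 2, c] * t₀ = l • 1 := by
      obtain ⟨-, hJ, hJ1⟩ := hT.superset
        (Set.mem_image_of_mem _ ⟨π / 2, rfl⟩)
      rw [hJ1, one_smul] at hJ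
      exact exists_transpose_mul_mul_eq_smul_one ht hsymm hJ
    have hdet : 0 < (t₀⁻¹ * g).det := by
      rw [det_mul, det_nonsing_inv, Ring.inverse_eq_inv']
      positivity
    obtain ⟨r, φ, ζ, θ, hr, hζ, hdec⟩ :=
      exists_smul_planeRotation_mul_diag_mul_planeRotation hdet
    have hdet_t : (t₀ * (r • planeRotation φ) * t₀⁻¹).det = r ^ 2 := by
      rw [det_conj ((Matrix.isUnit_iff_isUnit_det _).2 ht), det_smul, det_planeRotation]
      simp
    refine ⟨t₀ * (r • planeRotation φ) * t₀⁻¹, ζ, θ, ⟨?_, ?_⟩, hζ, ?_⟩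
    · rw [hdet_t]
      exact (pow_pos hr 2).ne'.isUnit
    · rw [hdet_t]
      refine transpose_mul_mul_conj ht hl ?_
      rw [transpose_smul, smul_mul_smul_comm, planeRotation_transpose_mul_self, sq]
    · change g = _ * planeRotation θ
      rw [Matrix.mul_assoc _ t₀⁻¹, Matrix.nonsing_inv_mul _ ht, Matrix.mul_one, Matrix.mul_assoc t₀,
        Matrix.mul_assoc t₀, ← hdec, Matrix.mul_nonsing_inv_cancel_left _ _ ht]
end

section
/- Let t₀ ∈ GL₂(ℝ) with det t₀ > 0 satisfy T¹ = t₀·SO(2)·t₀^{-1}. For λ ∈ ℝ^× and ζ ≥ 1 set g(λ,ζ) := the block-diagonal matrix diag(λ·t₀·diag(ζ,ζ^{-1}), ᵀt₀^{-1}·diag(ζ^{-1},ζ)) ∈ GSp₄(ℝ). Then GSp₄(ℝ) = ⋃_{λ∈ℝ^×, ζ≥1} R(ℝ)·g(λ,ζ)·K^H_∞, and the double cosets R(ℝ)·g(λ,ζ)·K^H_∞ for distinct pairs (λ, ζ) ∈ ℝ^× × [1,∞) are pairwise disjoint. -/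
open Matrix

/-- The matrix of the complex number `p - q i` acting on the plane. -/
def rotScale (p q : ℝ) : Matrix (Fin 2) (Fin 2) ℝ := !![p, q; -q, p]

lemma det_rotScale (p q : ℝ) : (rotScale p q).det = p ^ 2 + q ^ 2 := by
  simp [rotScale, det_fin_two]; ring

lemma rotScale_mul_transpose (p q : ℝ) :
    rotScale p q * (rotScale p q)ᵀ = (p ^ 2 + q ^ 2) • 1 := by
  ext i j; fin_cases i <;> fin_cases j <;> simp [rotScale, mul_apply, Fin.sum_univ_two] <;> ring

lemma transpose_mul_rotScale (p q : ℝ) :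
    (rotScale p q)ᵀ * rotScale p q = (p ^ 2 + q ^ 2) • 1 := by
  ext i j; fin_cases i <;> fin_cases j <;> simp [rotScale, mul_apply, Fin.sum_univ_two] <;> ring

lemma eq_rotScale_of_transpose_mul_self {h : Matrix (Fin 2) (Fin 2) ℝ}
    (hh : hᵀ * h = h.det • 1) : h = rotScale (h 0 0) (h 0 1) := by
  have e0 := congrFun (congrFun hh 0) 0
  have e1 := congrFun (congrFun hh 1) 1
  simp [mul_apply, Fin.sum_univ_two, det_fin_two] at e0 e1
  have s1 : h 1 1 = h 0 0 := by nlinarith [sq_nonneg (h 1 1 - h 0 0), sq_nonneg (h 0 1 + h 1 0)]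
  have s2 : h 1 0 = -h 0 1 := by nlinarith [sq_nonneg (h 1 1 - h 0 0), sq_nonneg (h 0 1 + h 1 0)]
  ext i j; fin_cases i <;> fin_cases j <;> simp [rotScale, s1, s2]

lemma eq_smul_one_of_symm_of_quarter_turn {N : Matrix (Fin 2) (Fin 2) ℝ} (hN : Nᵀ = N)
    (h : (rotScale 0 1)ᵀ * N * rotScale 0 1 = N) : N = N 0 0 • 1 := by
  have e0 := congrFun (congrFun h 0) 0
  have e1 := congrFun (congrFun h 0) 1
  have e2 := congrFun (congrFun hN 0) 1
  simp [rotScale, mul_apply, Fin.sum_univ_two] at e0 e1 e2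
  ext i j; fin_cases i <;> fin_cases j <;> simp <;> linarith

/-- If the special stabiliser of a nondegenerate symmetric form contains `t₀ SO(2) t₀⁻¹`, then `t₀`
carries the form to a multiple of the standard one. -/
lemma transpose_mul_mul_eq_smul_one {S t₀ : Matrix (Fin 2) (Fin 2) ℝ} (hSt : Sᵀ = S)
    (hS : S.det ≠ 0) (ht₀ : t₀.det ≠ 0)
    (hT : (t₀ * rotScale 0 1 * t₀⁻¹)ᵀ * S * (t₀ * rotScale 0 1 * t₀⁻¹) = S) :
    ∃ κ : ℝ, κ ≠ 0 ∧ t₀ᵀ * S * t₀ = κ • 1 := by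
  have key : t₀ᵀ * S * t₀ = (t₀ᵀ * S * t₀) 0 0 • 1 := by
    apply eq_smul_one_of_symm_of_quarter_turn
    · simp [transpose_mul, hSt, Matrix.mul_assoc]
    · conv_rhs => rw [← hT]
      simp [transpose_mul, transpose_nonsing_inv, Matrix.mul_assoc, ht₀]
  refine ⟨_, fun h0 => ?_, key⟩
  rw [h0, zero_smul] at key
  have := congrArg det key
  simp [hS, ht₀] at this

lemma exists_rotScale_of_similitude {S t₀ t : Matrix (Fin 2) (Fin 2) ℝ} (ht₀ : t₀.det ≠ 0)
    {κ : ℝ} (hκ : κ ≠ 0) (hS : t₀ᵀ * S * t₀ = κ • 1) (ht : IsUnit t.det)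
    (h : tᵀ * S * t = t.det • S) :
    ∃ p q : ℝ, p ^ 2 + q ^ 2 ≠ 0 ∧ t = t₀ * rotScale p q * t₀⁻¹ := by
  have hu : IsUnit t₀.det := isUnit_iff_ne_zero.2 ht₀
  obtain ⟨g, rfl⟩ : ∃ g, t = t₀ * g * t₀⁻¹ := ⟨t₀⁻¹ * t * t₀, by simp [Matrix.mul_assoc, ht₀]⟩
  have hd : (t₀ * g * t₀⁻¹).det = g.det := det_conj (by rwa [isUnit_iff_isUnit_det]) g
  rw [hd] at h ht
  have h2 : gᵀ * g = g.det • 1 := by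
    have := congrArg (fun M => t₀ᵀ * M * t₀) h
    simp only [Matrix.mul_smul, Matrix.smul_mul, hS] at this
    have e : t₀ᵀ * ((t₀ * g * t₀⁻¹)ᵀ * S * (t₀ * g * t₀⁻¹)) * t₀ = gᵀ * (t₀ᵀ * S * t₀) * g := by
      simp [transpose_mul, transpose_nonsing_inv, Matrix.mul_assoc, ht₀]
    rw [e, hS, Matrix.mul_smul, Matrix.smul_mul, Matrix.mul_one, smul_comm] at this
    exact smul_right_injective _ hκ this
  have h3 := eq_rotScale_of_transpose_mul_self h2
  refine ⟨g 0 0, g 0 1, ?_, by rw [← h3]⟩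
  rw [← det_rotScale, ← h3]; exact ht.ne_zero

lemma similitude_of_rotScale {S t₀ : Matrix (Fin 2) (Fin 2) ℝ} (ht₀ : t₀.det ≠ 0)
    {κ : ℝ} (hS : t₀ᵀ * S * t₀ = κ • 1) (p q : ℝ) :
    (t₀ * rotScale p q * t₀⁻¹)ᵀ * S * (t₀ * rotScale p q * t₀⁻¹)
      = (t₀ * rotScale p q * t₀⁻¹).det • S := by
  have hu : IsUnit t₀.det := isUnit_iff_ne_zero.2 ht₀
  rw [det_conj (by rwa [isUnit_iff_isUnit_det]), det_rotScale]
  have hS' : S = t₀ᵀ⁻¹ * (κ • 1) * t₀⁻¹ := by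
    rw [← hS]; simp [Matrix.mul_assoc, ht₀]
  have e : (t₀ * rotScale p q * t₀⁻¹)ᵀ * S * (t₀ * rotScale p q * t₀⁻¹)
      = t₀ᵀ⁻¹ * ((rotScale p q)ᵀ * (t₀ᵀ * S * t₀) * rotScale p q) * t₀⁻¹ := by
    simp [transpose_mul, transpose_nonsing_inv, Matrix.mul_assoc]
  rw [e, hS, Matrix.mul_smul, Matrix.mul_one, Matrix.smul_mul, transpose_mul_rotScale]
  conv_rhs => rw [hS']
  simp [smul_smul, mul_comm]

lemma det_smul_inv_transpose_conj_rotScale {t₀ : Matrix (Fin 2) (Fin 2) ℝ} (ht₀ : t₀.det ≠ 0)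
    {p q : ℝ} (hpq : p ^ 2 + q ^ 2 ≠ 0) :
    (t₀ * rotScale p q * t₀⁻¹).det • ((t₀ * rotScale p q * t₀⁻¹)ᵀ)⁻¹
      = t₀ᵀ⁻¹ * rotScale p q * t₀ᵀ := by
  have hu : IsUnit t₀.det := isUnit_iff_ne_zero.2 ht₀
  rw [det_conj (by rwa [isUnit_iff_isUnit_det]), det_rotScale]
  have : ((t₀ * rotScale p q * t₀⁻¹)ᵀ)⁻¹
      = (p ^ 2 + q ^ 2)⁻¹ • (t₀ᵀ⁻¹ * rotScale p q * t₀ᵀ) := by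
    apply inv_eq_right_inv
    have e : (t₀ * rotScale p q * t₀⁻¹)ᵀ * (t₀ᵀ⁻¹ * rotScale p q * t₀ᵀ)
        = t₀ᵀ⁻¹ * ((rotScale p q)ᵀ * rotScale p q) * t₀ᵀ := by
      simp [transpose_mul, transpose_nonsing_inv, Matrix.mul_assoc, ht₀]
    rw [Matrix.mul_smul, e, transpose_mul_rotScale]
    simp [ht₀, smul_smul, hpq]
  rw [this, smul_smul, mul_inv_cancel₀ hpq, one_smul]

lemma exists_rotScale_diagonalization {N : Matrix (Fin 2) (Fin 2) ℝ} (hN : N.PosDef) :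
    ∃ p q ζ : ℝ, p ^ 2 + q ^ 2 ≠ 0 ∧ 1 ≤ ζ ∧
      (rotScale p q * !![ζ⁻¹, 0; 0, ζ]) * (rotScale p q * !![ζ⁻¹, 0; 0, ζ])ᵀ = N := by
  have hdet := hN.det_pos
  have h00 : 0 < N 0 0 := hN.diag_pos
  have hs : N 1 0 = N 0 1 := by simpa using hN.1.apply 0 1
  rw [det_fin_two, hs] at hdet
  have h11 : 0 < N 1 1 := hN.diag_pos
  set z : ℂ := ⟨-(N 0 0 - N 1 1) / 2, N 0 1⟩ with hz
  have hr0 := norm_nonneg z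
  have hr2 : ‖z‖ ^ 2 = ((N 0 0 - N 1 1) / 2) ^ 2 + N 0 1 ^ 2 := by
    rw [Complex.sq_norm, Complex.normSq_apply]; simp [hz]; ring
  have hre : ‖z‖ * Real.cos (2 * (z.arg / 2)) = -(N 0 0 - N 1 1) / 2 := by
    rw [mul_div_cancel₀ _ (two_ne_zero)]; exact Complex.norm_mul_cos_arg z
  have him : ‖z‖ * Real.sin (2 * (z.arg / 2)) = N 0 1 := by
    rw [mul_div_cancel₀ _ (two_ne_zero)]; exact Complex.norm_mul_sin_arg z
  rw [Real.cos_two_mul'] at hre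
  rw [Real.sin_two_mul] at him
  have hcs := Real.cos_sq_add_sin_sq (z.arg / 2)
  generalize Real.cos (z.arg / 2) = c at *
  generalize Real.sin (z.arg / 2) = s at *
  generalize ‖z‖ = r at *
  have hα : 0 < (N 0 0 + N 1 1) / 2 - r := by
    have : r < (N 0 0 + N 1 1) / 2 := by
      apply lt_of_pow_lt_pow_left₀ 2 (by positivity); nlinarith
    linarith
  have fourth (x : ℝ) (hx : 0 < x) : ∃ e : ℝ, 0 < e ∧ e ^ 4 = x :=
    ⟨√√x, by positivity, by
      rw [show (4 : ℕ) = 2 * 2 from rfl, pow_mul, Real.sq_sqrt (by positivity), Real.sq_sqrt hx.le]⟩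
  obtain ⟨e, he, he4⟩ := fourth _ hα
  obtain ⟨f, hf, hf4⟩ := fourth ((N 0 0 + N 1 1) / 2 + r) (by linarith)
  have hef : e ≤ f := le_of_pow_le_pow_left₀ (n := 4) (by norm_num) hf.le (by linarith)
  refine ⟨e * f * c, e * f * s, f / e, ?_, (one_le_div he).2 hef, ?_⟩
  · have : (e * f * c) ^ 2 + (e * f * s) ^ 2 = (e * f) ^ 2 := by linear_combination (e * f) ^ 2 * hcs
    rw [this]; positivity
  · have hprod : rotScale (e * f * c) (e * f * s) * !![(f / e)⁻¹, 0; 0, f / e]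
        = !![e ^ 2 * c, f ^ 2 * s; -(e ^ 2 * s), f ^ 2 * c] := by
      ext i j; fin_cases i <;> fin_cases j <;>
        simp [rotScale, mul_apply, Fin.sum_univ_two] <;> field_simp
    rw [hprod]
    ext i j; fin_cases i <;> fin_cases j <;> simp [mul_apply, Fin.sum_univ_two, hs]
    · linear_combination c ^ 2 * he4 + s ^ 2 * hf4 + (N 0 0 + N 1 1) / 2 * hcs - hre
    · linear_combination -(c * s) * he4 + c * s * hf4 + him
    · linear_combination -(c * s) * he4 + c * s * hf4 + him
    · linear_combination s ^ 2 * he4 + c ^ 2 * hf4 + (N 0 0 + N 1 1) / 2 * hcs + hre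

lemma unitary_block_mul_transpose {n : Type*} [Fintype n] [DecidableEq n] {A B : Matrix n n ℝ}
    (h₁ : Aᵀ * B = Bᵀ * A) (h₂ : Aᵀ * A + Bᵀ * B = 1) :
    fromBlocks A B (-B) A * (fromBlocks A B (-B) A)ᵀ = 1 := by
  rw [mul_eq_one_comm, fromBlocks_transpose, fromBlocks_multiply, ← fromBlocks_one]
  congr 1
  · simpa using h₂
  · simp [h₁]
  · simp [h₁]
  · simpa [add_comm] using h₂

lemma unitary_block_commute_J {n : Type*} [Fintype n] [DecidableEq n] (A B : Matrix n n ℝ) :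
    fromBlocks A B (-B) A * fromBlocks 0 1 (-1) 0
      = fromBlocks 0 1 (-1) 0 * fromBlocks A B (-B) A := by
  simp [fromBlocks_multiply]

lemma mul_unitary_block_symplectic {n : Type*} [Fintype n] [DecidableEq n] {A B : Matrix n n ℝ}
    (h : fromBlocks A B (-B) A * (fromBlocks A B (-B) A)ᵀ = 1) (y : Matrix (n ⊕ n) (n ⊕ n) ℝ) :
    y * fromBlocks A B (-B) A * fromBlocks 0 1 (-1) 0 * (y * fromBlocks A B (-B) A)ᵀ
      = y * fromBlocks 0 1 (-1) 0 * yᵀ := by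
  rw [transpose_mul, Matrix.mul_assoc y, unitary_block_commute_J]
  simp only [Matrix.mul_assoc]
  rw [← Matrix.mul_assoc (fromBlocks A B (-B) A), h, Matrix.one_mul]

lemma toBlocks₂₂_upper_mul_unitary_mul_transpose {n : Type*} [Fintype n] [DecidableEq n]
    {A B : Matrix n n ℝ} (h₁ : Aᵀ * B = Bᵀ * A) (h₂ : Aᵀ * A + Bᵀ * B = 1) (E F P : Matrix n n ℝ) :
    (fromBlocks E F 0 P * fromBlocks A B (-B) A
      * (fromBlocks E F 0 P * fromBlocks A B (-B) A)ᵀ).toBlocks₂₂ = P * Pᵀ := by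
  rw [transpose_mul, Matrix.mul_assoc, ← Matrix.mul_assoc (fromBlocks A B (-B) A),
    unitary_block_mul_transpose h₁ h₂, Matrix.one_mul, fromBlocks_transpose, fromBlocks_multiply]
  simp

lemma toBlocks₁₂_upper_mul_unitary_symplectic {n : Type*} [Fintype n] [DecidableEq n]
    {A B : Matrix n n ℝ} (h₁ : Aᵀ * B = Bᵀ * A) (h₂ : Aᵀ * A + Bᵀ * B = 1) (E F P : Matrix n n ℝ) :
    (fromBlocks E F 0 P * fromBlocks A B (-B) A * fromBlocks 0 1 (-1) 0
      * (fromBlocks E F 0 P * fromBlocks A B (-B) A)ᵀ).toBlocks₁₂ = E * Pᵀ := by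
  rw [mul_unitary_block_symplectic (unitary_block_mul_transpose h₁ h₂), fromBlocks_transpose,
    fromBlocks_multiply, fromBlocks_multiply]
  simp

lemma mul_J_mul_transpose_of_transpose_mul_J_mul {n : Type*} [Fintype n] [DecidableEq n]
    {g : Matrix (n ⊕ n) (n ⊕ n) ℝ} {μ : ℝ} (hμ : μ ≠ 0)
    (hg : gᵀ * fromBlocks 0 1 (-1) 0 * g = μ • fromBlocks 0 1 (-1) 0) :
    g * fromBlocks 0 1 (-1) 0 * gᵀ = μ • fromBlocks 0 1 (-1) 0 := by
  set J : Matrix (n ⊕ n) (n ⊕ n) ℝ := fromBlocks 0 1 (-1) 0 with hJ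
  have hJJ : J * J = -1 := by
    rw [hJ, fromBlocks_multiply, ← fromBlocks_one, fromBlocks_neg]; simp
  have h1 : (-μ⁻¹ • (J * gᵀ * J)) * g = 1 := by
    rw [Matrix.smul_mul, Matrix.mul_assoc J, Matrix.mul_assoc J, hg, Matrix.mul_smul, hJJ]
    simp [smul_smul, hμ]
  rw [mul_eq_one_comm, Matrix.mul_smul] at h1
  have h2 : g * (J * gᵀ * J) = (-μ) • 1 := by
    rw [← h1, smul_smul]; simp [hμ]
  have h3 := congrArg (· * J) h2
  simp only [Matrix.mul_assoc, hJJ, Matrix.smul_mul, Matrix.one_mul] at h3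
  rw [Matrix.mul_assoc]
  simpa using h3

lemma bessel_block_mul {t₀ : Matrix (Fin 2) (Fin 2) ℝ} (ht₀ : t₀.det ≠ 0)
    {p q : ℝ} (hpq : p ^ 2 + q ^ 2 ≠ 0) (X Z W : Matrix (Fin 2) (Fin 2) ℝ) (lam : ℝ) :
    fromBlocks (t₀ * rotScale p q * t₀⁻¹) 0 0
        ((t₀ * rotScale p q * t₀⁻¹).det • ((t₀ * rotScale p q * t₀⁻¹)ᵀ)⁻¹) * fromBlocks 1 X 0 1
      * fromBlocks (lam • (t₀ * Z)) 0 0 (t₀ᵀ⁻¹ * W)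
      = fromBlocks (lam • (t₀ * rotScale p q * Z))
          (t₀ * rotScale p q * (t₀⁻¹ * X * t₀ᵀ⁻¹) * W) 0 (t₀ᵀ⁻¹ * rotScale p q * W) := by
  rw [det_smul_inv_transpose_conj_rotScale ht₀ hpq, fromBlocks_multiply, fromBlocks_multiply]
  congr 1 <;> simp [Matrix.mul_assoc, ht₀]

lemma eq_of_sq_add_inv_sq_eq {x y : ℝ} (hx : 1 ≤ x) (hy : 1 ≤ y)
    (h : x ^ 2 + (x⁻¹) ^ 2 = y ^ 2 + (y⁻¹) ^ 2) : x = y := by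
  have hx0 : 0 < x := by linarith
  have hy0 : 0 < y := by linarith
  field_simp at h
  have h' : (x - y) * ((x + y) * (x ^ 2 * y ^ 2 - 1)) = 0 := by linear_combination h
  rcases mul_eq_zero.1 h' with h1 | h1
  · linarith
  rcases mul_eq_zero.1 h1 with h2 | h2
  · linarith
  have : x * y = 1 := by nlinarith [mul_pos hx0 hy0]
  nlinarith

lemma torus_mul_dual_transpose {t₀ : Matrix (Fin 2) (Fin 2) ℝ} (ht₀ : t₀.det ≠ 0)
    (p q : ℝ) {z : ℝ} (hz : z ≠ 0) :
    (t₀ * rotScale p q * !![z, 0; 0, z⁻¹]) * (t₀ᵀ⁻¹ * rotScale p q * !![z⁻¹, 0; 0, z])ᵀ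
      = (p ^ 2 + q ^ 2) • 1 := by
  have hW : !![z, 0; 0, z⁻¹] * !![z⁻¹, 0; 0, z]ᵀ = 1 := by
    ext i j; fin_cases i <;> fin_cases j <;> simp [mul_apply, Fin.sum_univ_two, hz]
  have e : (t₀ * rotScale p q * !![z, 0; 0, z⁻¹]) * (t₀ᵀ⁻¹ * rotScale p q * !![z⁻¹, 0; 0, z])ᵀ
      = t₀ * (rotScale p q * (!![z, 0; 0, z⁻¹] * !![z⁻¹, 0; 0, z]ᵀ) * (rotScale p q)ᵀ) * t₀⁻¹ := by
    simp only [transpose_mul, transpose_nonsing_inv, Matrix.mul_assoc, transpose_transpose]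
  rw [e, hW, Matrix.mul_one, rotScale_mul_transpose]
  simp [ht₀]

/-- The similitude factor and the lower right block of `x xᵀ` separate the double cosets. -/
lemma parameters_eq {t₀ : Matrix (Fin 2) (Fin 2) ℝ} (ht₀ : t₀.det ≠ 0)
    {p q p' q' lam lam' ζ ζ' : ℝ} (hpq : p ^ 2 + q ^ 2 ≠ 0) (hζ : 1 ≤ ζ) (hζ' : 1 ≤ ζ')
    (h₁ : (t₀ᵀ⁻¹ * rotScale p q * !![ζ⁻¹, 0; 0, ζ]) * (t₀ᵀ⁻¹ * rotScale p q * !![ζ⁻¹, 0; 0, ζ])ᵀ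
      = (t₀ᵀ⁻¹ * rotScale p' q' * !![ζ'⁻¹, 0; 0, ζ'])
        * (t₀ᵀ⁻¹ * rotScale p' q' * !![ζ'⁻¹, 0; 0, ζ'])ᵀ)
    (h₂ : (lam • (t₀ * rotScale p q * !![ζ, 0; 0, ζ⁻¹]))
        * (t₀ᵀ⁻¹ * rotScale p q * !![ζ⁻¹, 0; 0, ζ])ᵀ
      = (lam' • (t₀ * rotScale p' q' * !![ζ', 0; 0, ζ'⁻¹]))
        * (t₀ᵀ⁻¹ * rotScale p' q' * !![ζ'⁻¹, 0; 0, ζ'])ᵀ) :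
    lam = lam' ∧ ζ = ζ' := by
  have hz : ζ ≠ 0 := by linarith
  have hz' : ζ' ≠ 0 := by linarith
  have conj (h W : Matrix (Fin 2) (Fin 2) ℝ) :
      t₀ᵀ * ((t₀ᵀ⁻¹ * h * W) * (t₀ᵀ⁻¹ * h * W)ᵀ) * t₀ = (h * W) * (h * W)ᵀ := by
    simp [transpose_mul, transpose_nonsing_inv, Matrix.mul_assoc, ht₀]
  have h₁' := congrArg (fun M => t₀ᵀ * M * t₀) h₁
  simp only [conj] at h₁'
  rw [Matrix.smul_mul, Matrix.smul_mul, torus_mul_dual_transpose ht₀ _ _ hz,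
    torus_mul_dual_transpose ht₀ _ _ hz'] at h₂
  have hm := congrFun (congrFun h₂ 0) 0
  have hd := congrArg det h₁'
  have htr := congrArg trace h₁'
  simp only [det_mul, det_transpose, det_rotScale, det_fin_two_of, inv_mul_cancel₀ hz,
    inv_mul_cancel₀ hz', mul_zero, sub_zero, mul_one] at hd
  simp at hm
  simp only [trace_fin_two, mul_apply, Fin.sum_univ_two, transpose_apply] at htr
  simp [rotScale] at htr
  have hs : p ^ 2 + q ^ 2 = p' ^ 2 + q' ^ 2 :=
    (mul_self_inj (by positivity) (by positivity)).1 hd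
  refine ⟨mul_right_cancel₀ hpq (by rw [hm, hs]), eq_of_sq_add_inv_sq_eq hζ hζ' ?_⟩
  apply mul_left_cancel₀ hpq
  conv_rhs => rw [hs]
  linear_combination htr

/-- A symplectic similitude matrix can be moved by a unitary block matrix to the block upper
triangular form of prescribed lower right block `P`, when `P Pᵀ` is the Gram matrix of its lower
rows. -/
lemma exists_upper_mul_unitary {n : Type*} [Fintype n] [DecidableEq n]
    {G₁ G₂ C D P : Matrix n n ℝ} {μ : ℝ} (hμ : μ ≠ 0)
    (hg : fromBlocks G₁ G₂ C D * fromBlocks 0 1 (-1) 0 * (fromBlocks G₁ G₂ C D)ᵀ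
      = μ • fromBlocks 0 1 (-1) 0)
    (hP : IsUnit P.det) (hM : P * Pᵀ = C * Cᵀ + D * Dᵀ) :
    ∃ A B F : Matrix n n ℝ, Aᵀ * B = Bᵀ * A ∧ Aᵀ * A + Bᵀ * B = 1 ∧
      F * P⁻¹ = (F * P⁻¹)ᵀ ∧
      fromBlocks G₁ G₂ C D = fromBlocks (μ • Pᵀ⁻¹) F 0 P * fromBlocks A B (-B) A := by
  have hP0 := hP.ne_zero
  have hg' := hg
  rw [fromBlocks_transpose, fromBlocks_multiply, fromBlocks_multiply, fromBlocks_smul,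
    fromBlocks_inj] at hg'
  obtain ⟨-, g12, -, g22⟩ := hg'
  simp at g12 g22
  have hCD : C * Dᵀ = D * Cᵀ := by rw [← sub_eq_zero, ← g22]; abel
  set A := P⁻¹ * D with hA
  set B := -(P⁻¹ * C) with hB
  have hAt : Aᵀ = Dᵀ * Pᵀ⁻¹ := by rw [hA, transpose_mul, transpose_nonsing_inv]
  have hBt : Bᵀ = -(Cᵀ * Pᵀ⁻¹) := by rw [hB, transpose_neg, transpose_mul, transpose_nonsing_inv]
  have h1 : fromBlocks A B (-B) A * (fromBlocks A B (-B) A)ᵀ = 1 := by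
    have e1 : A * Aᵀ + B * Bᵀ = 1 := by
      have : A * Aᵀ + B * Bᵀ = P⁻¹ * (C * Cᵀ + D * Dᵀ) * Pᵀ⁻¹ := by
        rw [hAt, hBt, hA, hB]; simp only [Matrix.neg_mul, Matrix.mul_neg, neg_neg]; noncomm_ring
      rw [this, ← hM]; simp [hP0]
    have e2 : B * Aᵀ = A * Bᵀ := by
      rw [hAt, hBt, hA, hB]
      have : P⁻¹ * (C * Dᵀ) * Pᵀ⁻¹ = P⁻¹ * (D * Cᵀ) * Pᵀ⁻¹ := by rw [hCD]
      simpa [Matrix.mul_assoc] using this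
    rw [fromBlocks_transpose, fromBlocks_multiply, ← fromBlocks_one]
    congr 1
    · simp [e2]
    · simp [e2]
    · simpa [add_comm] using e1
  have h1' := mul_eq_one_comm.1 h1
  rw [fromBlocks_transpose, fromBlocks_multiply, ← fromBlocks_one, fromBlocks_inj] at h1'
  obtain ⟨k1, k2, -, -⟩ := h1'
  simp at k1 k2
  have hy : fromBlocks G₁ G₂ C D * (fromBlocks A B (-B) A)ᵀ
      = fromBlocks (μ • Pᵀ⁻¹) (G₁ * -Bᵀ + G₂ * Aᵀ) 0 P := by
    rw [fromBlocks_transpose, fromBlocks_multiply]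
    congr 1
    · rw [hAt, hBt]
      have : (-(G₂ * Cᵀ) + G₁ * Dᵀ) * Pᵀ⁻¹ = μ • Pᵀ⁻¹ := by rw [g12]; simp
      rw [← this]; noncomm_ring
    · rw [hAt, hBt, Matrix.mul_neg, ← Matrix.mul_assoc, ← Matrix.mul_assoc, hCD, add_neg_cancel]
    · rw [transpose_neg, hAt, hBt]
      have : (C * Cᵀ + D * Dᵀ) * Pᵀ⁻¹ = P := by rw [← hM]; simp [Matrix.mul_assoc, hP0]
      conv_rhs => rw [← this]
      noncomm_ring
  have hx : fromBlocks G₁ G₂ C D = fromBlocks (μ • Pᵀ⁻¹) (G₁ * -Bᵀ + G₂ * Aᵀ) 0 P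
      * fromBlocks A B (-B) A := by
    rw [← hy, Matrix.mul_assoc, mul_eq_one_comm.1 h1, Matrix.mul_one]
  refine ⟨A, B, _, add_neg_eq_zero.1 k2, k1, ?_, hx⟩
  generalize G₁ * -Bᵀ + G₂ * Aᵀ = F at hx
  rw [hx, mul_unitary_block_symplectic h1, fromBlocks_transpose, fromBlocks_multiply, fromBlocks_multiply, fromBlocks_smul, fromBlocks_inj] at hg
  have h11 := hg.1
  simp [transpose_nonsing_inv] at h11
  have : Pᵀ⁻¹ * Fᵀ = F * P⁻¹ := by
    apply smul_right_injective _ hμ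
    show μ • _ = μ • _
    rw [← sub_eq_zero, ← h11]; abel
  rw [transpose_mul, transpose_nonsing_inv, this]

lemma posDef_gram_lower {n : Type*} [Fintype n] [DecidableEq n]
    {G₁ G₂ C D : Matrix n n ℝ} (hg : IsUnit (fromBlocks G₁ G₂ C D).det) :
    (C * Cᵀ + D * Dᵀ).PosDef := by
  have h := PosDef.mul_conjTranspose_self (fromBlocks G₁ G₂ C D)
    (vecMul_injective_of_isUnit ((isUnit_iff_isUnit_det _).2 hg))
  have h2 := h.submatrix (e := Sum.inr) Sum.inr_injective
  rw [conjTranspose_eq_transpose_of_trivial, fromBlocks_transpose, fromBlocks_multiply] at h2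
  exact h2

open Matrix

/-- **Disjoint double coset decomposition `GSp₄(ℝ) = ⊔ R(ℝ)·g(λ,ζ)·K^H_∞`.**
Let `a, b, c ∈ ℝ` with `S = [[a,b/2],[b/2,c]]` positive definite, `T(ℝ)` the
corresponding torus, `R(ℝ) = T(ℝ)U(ℝ)` the Bessel subgroup of `GSp₄(ℝ)`
(matrices indexed by `Fin 2 ⊕ Fin 2`, written in `2×2` blocks), and `K^H_∞` the
standard maximal compact subgroup.  Let `t₀ ∈ GL₂⁺(ℝ)` with `T¹ = t₀·SO(2)·t₀⁻¹`,
and `g(λ,ζ) = diag(λ·t₀·diag(ζ,ζ⁻¹), ᵀt₀⁻¹·diag(ζ⁻¹,ζ))`.  Then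
`GSp₄(ℝ) = ⋃_{λ∈ℝ^×, ζ≥1} R(ℝ)·g(λ,ζ)·K^H_∞`, and these double cosets are
pairwise disjoint. -/
theorem real_bessel_double_coset_decomposition
    (a b c : ℝ) (hS : (!![a, b / 2; b / 2, c] : Matrix (Fin 2) (Fin 2) ℝ).PosDef)
    (t₀ : Matrix (Fin 2) (Fin 2) ℝ) (ht₀ : 0 < t₀.det)
    (ht₀T : {g : Matrix (Fin 2) (Fin 2) ℝ | IsUnit g.det ∧
        gᵀ * !![a, b / 2; b / 2, c] * g = g.det • !![a, b / 2; b / 2, c] ∧ g.det = 1}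
      = (fun k => t₀ * k * t₀⁻¹) ''
          {k | ∃ θ : ℝ, k = !![Real.cos θ, Real.sin θ; -Real.sin θ, Real.cos θ]})
    (GSp4 : Set (Matrix (Fin 2 ⊕ Fin 2) (Fin 2 ⊕ Fin 2) ℝ))
    (hGSp4 : GSp4 = {g | IsUnit g.det ∧ ∃ μ : ℝ, μ ≠ 0 ∧
      gᵀ * Matrix.fromBlocks 0 1 (-1) 0 * g = μ • Matrix.fromBlocks 0 1 (-1) 0})
    (R : Set (Matrix (Fin 2 ⊕ Fin 2) (Fin 2 ⊕ Fin 2) ℝ))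
    (hR : R = {r | ∃ t : Matrix (Fin 2) (Fin 2) ℝ, IsUnit t.det ∧
        tᵀ * !![a, b / 2; b / 2, c] * t = t.det • !![a, b / 2; b / 2, c] ∧
      ∃ X : Matrix (Fin 2) (Fin 2) ℝ, Xᵀ = X ∧
        r = Matrix.fromBlocks t 0 0 (t.det • (tᵀ)⁻¹) * Matrix.fromBlocks 1 X 0 1})
    (KH : Set (Matrix (Fin 2 ⊕ Fin 2) (Fin 2 ⊕ Fin 2) ℝ))
    (hKH : KH = {k | ∃ A B : Matrix (Fin 2) (Fin 2) ℝ,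
      Aᵀ * B = Bᵀ * A ∧ Aᵀ * A + Bᵀ * B = 1 ∧ k = Matrix.fromBlocks A B (-B) A})
    (DC : ℝ → ℝ → Set (Matrix (Fin 2 ⊕ Fin 2) (Fin 2 ⊕ Fin 2) ℝ))
    (hDC : ∀ lam zeta : ℝ, DC lam zeta = {x | ∃ r ∈ R, ∃ k ∈ KH,
      x = r * Matrix.fromBlocks (lam • (t₀ * !![zeta, 0; 0, zeta⁻¹])) 0 0
            ((t₀ᵀ)⁻¹ * !![zeta⁻¹, 0; 0, zeta]) * k}) :
    (∀ g ∈ GSp4, ∃ lam zeta : ℝ, lam ≠ 0 ∧ 1 ≤ zeta ∧ g ∈ DC lam zeta) ∧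
    (∀ lam zeta lam' zeta' : ℝ, lam ≠ 0 → 1 ≤ zeta → lam' ≠ 0 → 1 ≤ zeta' →
      (lam, zeta) ≠ (lam', zeta') → DC lam zeta ∩ DC lam' zeta' = ∅) := by
  have ht₀0 : t₀.det ≠ 0 := ht₀.ne'
  obtain ⟨κ, hκ, hκS⟩ := transpose_mul_mul_eq_smul_one (S := !![a, b / 2; b / 2, c]) (t₀ := t₀)
    (by ext i j; fin_cases i <;> fin_cases j <;> simp) hS.det_pos.ne' ht₀0 (by
      have hmem : t₀ * rotScale 0 1 * t₀⁻¹ ∈ (fun k => t₀ * k * t₀⁻¹) ''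
          {k | ∃ θ : ℝ, k = !![Real.cos θ, Real.sin θ; -Real.sin θ, Real.cos θ]} :=
        ⟨rotScale 0 1, ⟨Real.pi / 2, by simp [rotScale]⟩, rfl⟩
      rw [← ht₀T] at hmem
      obtain ⟨-, h1, h2⟩ := hmem
      rwa [h2, one_smul] at h1)
  subst hGSp4 hR hKH
  constructor
  · rintro g ⟨hgu, μ, hμ, hg⟩
    obtain ⟨G₁, G₂, C, D, rfl⟩ : ∃ G₁ G₂ C D, g = fromBlocks G₁ G₂ C D :=
      ⟨_, _, _, _, (fromBlocks_toBlocks g).symm⟩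
    have hM := posDef_gram_lower hgu
    have hN := hM.conjTranspose_mul_mul_same (B := t₀)
      (mulVec_injective_of_isUnit ((isUnit_iff_isUnit_det _).2 ht₀0.isUnit))
    rw [conjTranspose_eq_transpose_of_trivial] at hN
    obtain ⟨p, q, ζ, hpq, hζ, hd⟩ := exists_rotScale_diagonalization hN
    have hz : ζ ≠ 0 := by linarith
    have hPdet : (t₀ᵀ⁻¹ * rotScale p q * !![ζ⁻¹, 0; 0, ζ]).det ≠ 0 := by
      simp [det_rotScale, hpq, ht₀0, hz, det_nonsing_inv]
    have hPM : (t₀ᵀ⁻¹ * rotScale p q * !![ζ⁻¹, 0; 0, ζ])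
        * (t₀ᵀ⁻¹ * rotScale p q * !![ζ⁻¹, 0; 0, ζ])ᵀ = C * Cᵀ + D * Dᵀ := by
      have := congrArg (fun M => t₀ᵀ⁻¹ * M * t₀⁻¹) hd
      simp only [transpose_mul] at this
      simpa [transpose_mul, transpose_nonsing_inv, Matrix.mul_assoc, ht₀0] using this
    obtain ⟨A, B, F, hAB, hAB1, hF, hx⟩ := exists_upper_mul_unitary hμ
      (mul_J_mul_transpose_of_transpose_mul_J_mul hμ hg) hPdet.isUnit hPM
    have hPinv : (t₀ᵀ⁻¹ * rotScale p q * !![ζ⁻¹, 0; 0, ζ])ᵀ⁻¹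
        = (p ^ 2 + q ^ 2)⁻¹ • (t₀ * rotScale p q * !![ζ, 0; 0, ζ⁻¹]) := by
      apply inv_eq_left_inv
      rw [Matrix.smul_mul, torus_mul_dual_transpose ht₀0 _ _ hz, smul_smul, inv_mul_cancel₀ hpq,
        one_smul]
    rw [hPinv, smul_smul] at hx
    set P := t₀ᵀ⁻¹ * rotScale p q * !![ζ⁻¹, 0; 0, ζ] with hP
    set Y := (p ^ 2 + q ^ 2)⁻¹ • ((rotScale p q)ᵀ * t₀⁻¹ * (F * P⁻¹) * t₀ᵀ⁻¹ * rotScale p q) with hY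
    have hYt : Yᵀ = Y := by
      rw [hY, transpose_smul]
      simp only [transpose_mul _ (rotScale p q), transpose_mul _ t₀ᵀ⁻¹, transpose_mul _ (F * P⁻¹),
        ← hF]
      simp [transpose_mul, transpose_nonsing_inv, Matrix.mul_assoc]
    have hFY : t₀ * rotScale p q * (t₀⁻¹ * (t₀ * Y * t₀ᵀ) * t₀ᵀ⁻¹) * !![ζ⁻¹, 0; 0, ζ] = F := by
      have e : t₀ * rotScale p q * (t₀⁻¹ * (t₀ * Y * t₀ᵀ) * t₀ᵀ⁻¹) * !![ζ⁻¹, 0; 0, ζ]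
          = (p ^ 2 + q ^ 2)⁻¹ • (t₀ * (rotScale p q * (rotScale p q)ᵀ) * t₀⁻¹ * (F * P⁻¹) * P) := by
        rw [hY]
        generalize F * P⁻¹ = Q
        rw [hP]
        simp [Matrix.mul_assoc, ht₀0]
      rw [e, rotScale_mul_transpose]
      simp [Matrix.mul_assoc, ht₀0, hPdet, smul_smul, hpq]
    refine ⟨μ * (p ^ 2 + q ^ 2)⁻¹, ζ, mul_ne_zero hμ (inv_ne_zero hpq), hζ, ?_⟩
    rw [hDC]
    refine ⟨_, ⟨t₀ * rotScale p q * t₀⁻¹, ?_, similitude_of_rotScale ht₀0 hκS p q, t₀ * Y * t₀ᵀ, ?_,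
      rfl⟩, _, ⟨A, B, hAB, hAB1, rfl⟩, ?_⟩
    · rw [det_conj ((isUnit_iff_isUnit_det _).2 ht₀0.isUnit), det_rotScale]
      exact hpq.isUnit
    · simp [transpose_mul, hYt, Matrix.mul_assoc]
    · rw [bessel_block_mul ht₀0 hpq, hFY]
      exact hx
  · intro lam ζ lam' ζ' _ hζ _ hζ' hne
    rw [Set.eq_empty_iff_forall_notMem]
    rintro x ⟨hx, hx'⟩
    rw [hDC] at hx hx'
    obtain ⟨r, ⟨t, htu, ht, X, -, rfl⟩, k, ⟨A, B, hAB, hAB1, rfl⟩, hx⟩ := hx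
    obtain ⟨r, ⟨t', htu', ht', X', -, rfl⟩, k, ⟨A', B', hAB', hAB1', rfl⟩, hx'⟩ := hx'
    obtain ⟨p, q, hpq, rfl⟩ := exists_rotScale_of_similitude ht₀0 hκ hκS htu ht
    obtain ⟨p', q', hpq', rfl⟩ := exists_rotScale_of_similitude ht₀0 hκ hκS htu' ht'
    rw [bessel_block_mul ht₀0 hpq] at hx
    rw [bessel_block_mul ht₀0 hpq'] at hx'
    have h1 := toBlocks₂₂_upper_mul_unitary_mul_transpose hAB hAB1
      (lam • (t₀ * rotScale p q * !![ζ, 0; 0, ζ⁻¹]))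
      (t₀ * rotScale p q * (t₀⁻¹ * X * t₀ᵀ⁻¹) * !![ζ⁻¹, 0; 0, ζ])
      (t₀ᵀ⁻¹ * rotScale p q * !![ζ⁻¹, 0; 0, ζ])
    have h2 := toBlocks₁₂_upper_mul_unitary_symplectic hAB hAB1
      (lam • (t₀ * rotScale p q * !![ζ, 0; 0, ζ⁻¹]))
      (t₀ * rotScale p q * (t₀⁻¹ * X * t₀ᵀ⁻¹) * !![ζ⁻¹, 0; 0, ζ])
      (t₀ᵀ⁻¹ * rotScale p q * !![ζ⁻¹, 0; 0, ζ])
    rw [← hx, hx', toBlocks₂₂_upper_mul_unitary_mul_transpose hAB' hAB1'] at h1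
    rw [← hx, hx', toBlocks₁₂_upper_mul_unitary_symplectic hAB' hAB1'] at h2
    obtain ⟨rfl, rfl⟩ := parameters_eq ht₀0 hpq hζ hζ' h1.symm h2.symm
    exact hne rfl
end
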